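/- Let [n,c] be a useful pair with c + n = k(k−1)/2 and k ≥ 2n, let d = 1 + (c−1)/n, let 𝔽 be the finite field of order c, ζ a generator of 𝔽ˣ, H ≤ Sym(𝔽) the group of affine permutations x ↦ ax + b with b ∈ 𝔽, a ∈ ⟨ζⁿ⟩, R = {0,…,d−1}, and G ≤ Sym(𝔽 × R) the group of permutations (x,j) ↦ (h_j(x), σ(j)) with h_j ∈ H, σ ∈ Sym(R). Let B = { (0,i), (ζⁱ,i) : 0 ≤ i ≤ n−1 } ∪ { (0,i) : n ≤ i ≤ k−n−1 }. Then B is a well-defined k-element subset of 𝔽 × R, and the pair 𝒟 = (𝔽 × R, ℬ) with block set ℬ = B^G (the G-orbit of B) is a 2-(cd, k, λ) design for some positive integer λ; G is a block-transitive group of automorphisms of 𝒟 preserving the partition into the d classes C_j = 𝔽 × {j} of size c; and B contains exactly n inner pairs and exactly c outer pairs, so the Delandtsheer–Doyen parameters of 𝒟 are (m,n) = (1,n). -/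

import Mathlib

open Finset

/-- Number of inner pairs of `B` with respect to the partition `𝒞`:
2-subsets of `B` contained in a single class of `𝒞`. -/
def innerPairs {P : Type*} [DecidableEq P] (𝒞 : Finset (Finset P)) (B : Finset P) : ℕ :=
  ((B.powersetCard 2).filter (fun p => ∃ C ∈ 𝒞, p ⊆ C)).card

/-- Number of outer pairs of `B` with respect to the partition `𝒞`:
2-subsets of `B` not contained in a single class of `𝒞`. -/
def outerPairs {P : Type*} [DecidableEq P] (𝒞 : Finset (Finset P)) (B : Finset P) : ℕ :=
  ((B.powersetCard 2).filter (fun p => ¬ ∃ C ∈ 𝒞, p ⊆ C)).card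

/-- The rank of a permutation group `X ≤ Sym(Ω)`: the number of `X`-orbits on `Ω × Ω`. -/
noncomputable def permRank {Ω : Type*} (X : Subgroup (Equiv.Perm Ω)) : ℕ :=
  Nat.card {O : Set (Ω × Ω) // ∃ p : Ω × Ω, O = {q | ∃ g ∈ X, (g p.1, g p.2) = q}}

/-- The pair-rank of a permutation group `X ≤ Sym(Ω)`: the number of `X`-orbits on
the 2-element subsets of `Ω`. -/
noncomputable def permPairRank {Ω : Type*} [DecidableEq Ω] (X : Subgroup (Equiv.Perm Ω)) : ℕ :=
  Nat.card {O : Set (Finset Ω) // ∃ s : Finset Ω, s.card = 2 ∧ O = {t | ∃ g ∈ X, s.image ⇑g = t}}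

/-- Double counting of flags: if `ℬ` is the orbit of `B` under `G`, and `G` is transitive on a
`G`-invariant set `O` of ordered pairs, then every pair of `O` lies in equally many blocks, and this
number is determined by the number of pairs of `O` inside `B`. -/
theorem card_blocks_mul_card_orbit {P : Type*} [DecidableEq P]
    {G : Subgroup (Equiv.Perm P)} {B : Finset P} {ℬ : Finset (Finset P)}
    (hℬ : ∀ s, s ∈ ℬ ↔ ∃ g ∈ G, B.image ⇑g = s) {O : Finset (P × P)}
    (hinv : ∀ g ∈ G, ∀ q ∈ O, (g q.1, g q.2) ∈ O)
    (htrans : ∀ q ∈ O, ∀ r ∈ O, ∃ g ∈ G, g q.1 = r.1 ∧ g q.2 = r.2)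
    {p : P × P} (hp : p ∈ O) :
    #{s ∈ ℬ | p.1 ∈ s ∧ p.2 ∈ s} * #O = #ℬ * #{q ∈ O | q.1 ∈ B ∧ q.2 ∈ B} := by
  have himg : ∀ g ∈ G, ∀ s ∈ ℬ, s.image ⇑g ∈ ℬ := by
    intro g hg s hs
    obtain ⟨g', hg', rfl⟩ := (hℬ s).1 hs
    exact (hℬ _).2 ⟨g * g', G.mul_mem hg hg', by simp [image_image]⟩
  have hle : ∀ q ∈ O, ∀ r ∈ O,
      #{s ∈ ℬ | q.1 ∈ s ∧ q.2 ∈ s} ≤ #{s ∈ ℬ | r.1 ∈ s ∧ r.2 ∈ s} := by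
    intro q hq r hr
    obtain ⟨g, hg, h1, h2⟩ := htrans q hq r hr
    refine card_le_card_of_injOn (fun s ↦ s.image ⇑g) ?_ (image_injective g.injective).injOn
    intro s hs
    simp only [coe_filter, Set.mem_ofPred_eq] at hs ⊢
    exact ⟨himg g hg s hs.1, h1 ▸ mem_image_of_mem g hs.2.1, h2 ▸ mem_image_of_mem g hs.2.2⟩
  have hblock : ∀ s ∈ ℬ,
      #{q ∈ O | q.1 ∈ s ∧ q.2 ∈ s} = #{q ∈ O | q.1 ∈ B ∧ q.2 ∈ B} := by
    intro s hs
    obtain ⟨g, hg, rfl⟩ := (hℬ s).1 hs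
    symm
    refine card_nbij' (fun q ↦ (g q.1, g q.2)) (fun q ↦ (g⁻¹ q.1, g⁻¹ q.2)) ?_ ?_ ?_ ?_
    · intro q hq
      simp only [coe_filter, Set.mem_ofPred_eq] at hq ⊢
      exact ⟨hinv g hg q hq.1, mem_image_of_mem g hq.2.1, mem_image_of_mem g hq.2.2⟩
    · intro q hq
      simp only [coe_filter, Set.mem_ofPred_eq, mem_image] at hq ⊢
      obtain ⟨hqO, ⟨x, hx, hx'⟩, y, hy, hy'⟩ := hq
      refine ⟨hinv _ (G.inv_mem hg) q hqO, ?_, ?_⟩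
      · simpa [← hx'] using hx
      · simpa [← hy'] using hy
    · intro q _; simp
    · intro q _; simp
  have hcount := sum_card_bipartiteAbove_eq_sum_card_bipartiteBelow
    (s := O) (t := ℬ) (fun q s ↦ q.1 ∈ s ∧ q.2 ∈ s)
  simp only [bipartiteAbove, bipartiteBelow] at hcount
  rw [sum_congr rfl fun q hq ↦ le_antisymm (hle q hq p hp) (hle p hp q hq),
    sum_congr rfl hblock] at hcount
  simpa [mul_comm] using hcount

/-- In a cyclic group generated by `ζ`, every coset of `⟨ζⁿ⟩` contains some `ζⁱ` with `i < n`. -/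
theorem exists_pow_lt_eq_mul {Γ : Type*} [CommGroup Γ] {ζ : Γ}
    (hζ : ∀ u, u ∈ Subgroup.zpowers ζ) {n : ℕ} (hn : 0 < n) (u : Γ) :
    ∃ i < n, ∃ a ∈ Subgroup.zpowers (ζ ^ n), ζ ^ i = a * u := by
  obtain ⟨m, rfl⟩ := Subgroup.mem_zpowers_iff.1 (hζ u)
  have hn' : (n : ℤ) ≠ 0 := by positivity
  have h0 := Int.emod_nonneg m hn'
  have h1 := Int.emod_lt_of_pos m (b := n) (by positivity)
  refine ⟨(m % n).toNat, by omega, (ζ ^ n) ^ (-(m / n)), Subgroup.zpow_mem_zpowers _ _, ?_⟩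
  rw [← zpow_natCast, Int.toNat_of_nonneg h0, ← zpow_natCast, ← zpow_mul, ← zpow_add]
  congr 1
  have := Int.emod_add_mul_ediv m n
  linarith

/-- If `n` divides the order of `ζ`, then the `ζⁱ` with `i < n` lie in distinct cosets
of `⟨ζⁿ⟩`. -/
theorem eq_of_pow_eq_mul_pow {Γ : Type*} [CommGroup Γ] {ζ : Γ} {n : ℕ} (hdvd : n ∣ orderOf ζ)
    {i j : ℕ} (hi : i < n) (hj : j < n) {a : Γ} (ha : a ∈ Subgroup.zpowers (ζ ^ n))
    (h : ζ ^ i = a * ζ ^ j) : i = j := by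
  obtain ⟨m, rfl⟩ := Subgroup.mem_zpowers_iff.1 ha
  rw [← zpow_natCast, ← zpow_natCast, ← zpow_natCast, ← zpow_mul, ← zpow_add,
    zpow_eq_zpow_iff_modEq] at h
  have h' := (h.of_dvd (Int.natCast_dvd_natCast.2 hdvd))
  have h'' : (i : ℤ) ≡ j [ZMOD n] :=
    h'.trans (by simp)
  exact Nat.ModEq.eq_of_lt_of_lt (Int.natCast_modEq_iff.1 h'') hi hj

/-- The symmetric group is transitive on ordered pairs of distinct points. -/
theorem exists_perm_apply_eq_apply_eq {α : Type*} [DecidableEq α] {a b a' b' : α}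
    (h : a ≠ b) (h' : a' ≠ b') : ∃ σ : Equiv.Perm α, σ a = a' ∧ σ b = b' := by
  refine ⟨Equiv.swap (Equiv.swap a a' b) b' * Equiv.swap a a', ?_, by simp⟩
  rw [Equiv.Perm.mul_apply, Equiv.swap_apply_left]
  refine Equiv.swap_apply_of_ne_of_ne (fun hb ↦ h ?_) h'
  exact (Equiv.swap a a').injective (by rw [Equiv.swap_apply_left]; exact hb)

/-- The permutation `(x, j) ↦ (h j x, σ j)` of `α × ι`. -/
def fiberwisePerm {α ι : Type*} (h : ι → Equiv.Perm α) (σ : Equiv.Perm ι) :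
    Equiv.Perm (α × ι) where
  toFun p := (h p.2 p.1, σ p.2)
  invFun q := ((h (σ.symm q.2)).symm q.1, σ.symm q.2)
  left_inv p := by simp
  right_inv q := by simp

/-- The affine permutation `x ↦ a * x + b`. -/
def affinePerm {𝔽 : Type*} [Field 𝔽] (a : 𝔽ˣ) (b : 𝔽) : Equiv.Perm 𝔽 where
  toFun x := a * x + b
  invFun y := (↑a⁻¹ : 𝔽) * (y - b)
  left_inv x := by simp
  right_inv y := by simp

section BaseBlock

variable {𝔽 : Type*} [Field 𝔽] {n k d : ℕ} {ζ : 𝔽ˣ} {B : Finset (𝔽 × Fin d)}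

/-- The distinct pairs of points of the base block in a common class. -/
theorem mem_baseBlock_inner_iff
    (hB : ∀ p : 𝔽 × Fin d, p ∈ B ↔
      ((p.1 = 0 ∧ (p.2 : ℕ) < k - n) ∨ (p.1 = (↑ζ : 𝔽) ^ (p.2 : ℕ) ∧ (p.2 : ℕ) < n)))
    (hnk : n ≤ k - n) (x y : 𝔽) (j : Fin d) :
    ((x, j) ∈ B ∧ (y, j) ∈ B ∧ x ≠ y) ↔
      (j : ℕ) < n ∧ (x = 0 ∧ y = (ζ : 𝔽) ^ (j : ℕ) ∨ x = (ζ : 𝔽) ^ (j : ℕ) ∧ y = 0) := by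
  have h0 : (ζ : 𝔽) ^ (j : ℕ) ≠ 0 := pow_ne_zero _ ζ.ne_zero
  simp only [hB]
  constructor
  · rintro ⟨⟨rfl, h1⟩ | ⟨rfl, h1⟩, ⟨rfl, h2⟩ | ⟨rfl, h2⟩, hne⟩ <;> simp_all
  · rintro ⟨hj, ⟨rfl, rfl⟩ | ⟨rfl, rfl⟩⟩
    · exact ⟨.inl ⟨rfl, by omega⟩, .inr ⟨rfl, hj⟩, h0.symm⟩
    · exact ⟨.inr ⟨rfl, hj⟩, .inl ⟨rfl, by omega⟩, h0⟩

theorem card_baseBlock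
    (hB : ∀ p : 𝔽 × Fin d, p ∈ B ↔
      ((p.1 = 0 ∧ (p.2 : ℕ) < k - n) ∨ (p.1 = (↑ζ : 𝔽) ^ (p.2 : ℕ) ∧ (p.2 : ℕ) < n)))
    (hnk : n ≤ k - n) (hkd : k - n ≤ d) : #B = k := by
  classical
  have hBeq : B = (univ : Finset (Fin (k - n))).image (fun i : Fin (k - n) ↦ ((0 : 𝔽), Fin.castLE hkd i)) ∪
      (univ : Finset (Fin n)).image
        (fun i : Fin n ↦ ((ζ : 𝔽) ^ (i : ℕ), Fin.castLE (hnk.trans hkd) i)) := by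
    ext ⟨x, j⟩
    simp only [hB, mem_union, mem_image, mem_univ, true_and, Prod.mk.injEq]
    constructor
    · rintro (⟨rfl, h⟩ | ⟨rfl, h⟩)
      · exact .inl ⟨⟨j, h⟩, rfl, rfl⟩
      · exact .inr ⟨⟨j, h⟩, rfl, rfl⟩
    · rintro (⟨i, rfl, rfl⟩ | ⟨i, rfl, rfl⟩)
      · exact .inl ⟨rfl, i.2⟩
      · exact .inr ⟨rfl, i.2⟩
  rw [hBeq, card_union_of_disjoint, card_image_of_injective, card_image_of_injective]
  · simp only [card_univ, Fintype.card_fin]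
    omega
  · intro i j h
    exact Fin.castLE_injective _ (Prod.mk.inj h).2
  · intro i j h
    exact Fin.castLE_injective _ (Prod.mk.inj h).2
  · rw [disjoint_left]
    rintro p hp hq
    simp only [mem_image, mem_univ, true_and] at hp hq
    obtain ⟨i, rfl⟩ := hp
    obtain ⟨j, hj⟩ := hq
    exact pow_ne_zero _ ζ.ne_zero (Prod.mk.inj hj).1

/-- The base block has `n` unordered pairs of points in a common class. -/
theorem card_baseBlock_innerPairs
    (hB : ∀ p : 𝔽 × Fin d, p ∈ B ↔
      ((p.1 = 0 ∧ (p.2 : ℕ) < k - n) ∨ (p.1 = (↑ζ : 𝔽) ^ (p.2 : ℕ) ∧ (p.2 : ℕ) < n)))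
    (hnk : n ≤ k - n) (hnd : n ≤ d) [Fintype 𝔽] [DecidableEq 𝔽]
    (𝒞 : Finset (Finset (𝔽 × Fin d)))
    (h𝒞 : ∀ s : Finset (𝔽 × Fin d),
      s ∈ 𝒞 ↔ ∃ j : Fin d, s = Finset.univ.filter fun p : 𝔽 × Fin d => p.2 = j) :
    innerPairs 𝒞 B = n := by
  have h0 : ∀ i : ℕ, (ζ : 𝔽) ^ i ≠ 0 := fun i ↦ pow_ne_zero _ ζ.ne_zero
  have heq : (B.powersetCard 2).filter (fun p ↦ ∃ C ∈ 𝒞, p ⊆ C) =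
      (univ : Finset (Fin n)).image (fun i : Fin n ↦
        {((0 : 𝔽), Fin.castLE hnd i), ((ζ : 𝔽) ^ (i : ℕ), Fin.castLE hnd i)}) := by
    ext p
    simp only [mem_filter, mem_powersetCard, mem_image, mem_univ, true_and]
    constructor
    · rintro ⟨⟨hpB, hp2⟩, C, hC, hpC⟩
      obtain ⟨j, rfl⟩ := (h𝒞 C).1 hC
      obtain ⟨⟨x, a⟩, ⟨y, b⟩, hne, rfl⟩ := card_eq_two.1 hp2
      have ha : a = j := by simpa using hpC (mem_insert_self _ _)
      have hb : b = j := by simpa using hpC (mem_insert_of_mem (mem_singleton_self _))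
      subst ha hb
      obtain ⟨hj, ⟨rfl, rfl⟩ | ⟨rfl, rfl⟩⟩ := (mem_baseBlock_inner_iff hB hnk x y b).1
        ⟨hpB (mem_insert_self _ _), hpB (mem_insert_of_mem (mem_singleton_self _)),
          fun h ↦ hne (by rw [h])⟩
      · exact ⟨⟨b, hj⟩, rfl⟩
      · exact ⟨⟨b, hj⟩, pair_comm _ _⟩
    · rintro ⟨i, rfl⟩
      obtain ⟨hx, hy, -⟩ := (mem_baseBlock_inner_iff hB hnk 0 _ (Fin.castLE hnd i)).2
        ⟨i.2, .inl ⟨rfl, rfl⟩⟩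
      refine ⟨⟨?_, card_pair fun h ↦ h0 i (Prod.mk.inj h).1.symm⟩, _,
        (h𝒞 _).2 ⟨Fin.castLE hnd i, rfl⟩, ?_⟩
      · exact insert_subset hx (singleton_subset_iff.2 hy)
      · simp [insert_subset_iff]
  rw [innerPairs, heq, card_image_of_injective, card_univ, Fintype.card_fin]
  intro i j h
  have hmem : ((0 : 𝔽), Fin.castLE hnd i) ∈
      ({((0 : 𝔽), Fin.castLE hnd j), ((ζ : 𝔽) ^ (j : ℕ), Fin.castLE hnd j)} :
        Finset (𝔽 × Fin d)) := by
    beta_reduce at h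
    rw [← h]
    exact mem_insert_self _ _
  simp only [mem_insert, mem_singleton, Prod.mk.injEq, (Fin.castLE_injective hnd).eq_iff] at hmem
  exact hmem.elim And.right And.right

/-- The base block has `2 * n` ordered pairs of distinct points in a common class. -/
theorem card_baseBlock_offDiag_inner
    (hB : ∀ p : 𝔽 × Fin d, p ∈ B ↔
      ((p.1 = 0 ∧ (p.2 : ℕ) < k - n) ∨ (p.1 = (↑ζ : 𝔽) ^ (p.2 : ℕ) ∧ (p.2 : ℕ) < n)))
    (hnk : n ≤ k - n) (hnd : n ≤ d) : #{q ∈ B.offDiag | q.1.2 = q.2.2} = 2 * n := by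
  classical
  have h0 : ∀ i : ℕ, (ζ : 𝔽) ^ i ≠ 0 := fun i ↦ pow_ne_zero _ ζ.ne_zero
  have heq : {q ∈ B.offDiag | q.1.2 = q.2.2} =
      (univ : Finset (Fin n)).image (fun i : Fin n ↦
        (((0 : 𝔽), Fin.castLE hnd i), ((ζ : 𝔽) ^ (i : ℕ), Fin.castLE hnd i))) ∪
      (univ : Finset (Fin n)).image (fun i : Fin n ↦
        (((ζ : 𝔽) ^ (i : ℕ), Fin.castLE hnd i), ((0 : 𝔽), Fin.castLE hnd i))) := by
    ext ⟨⟨x, a⟩, y, b⟩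
    simp only [mem_filter, mem_offDiag, mem_union, mem_image, mem_univ, true_and, Prod.mk.injEq]
    constructor
    · rintro ⟨⟨hx, hy, hne⟩, rfl⟩
      obtain ⟨hj, ⟨rfl, rfl⟩ | ⟨rfl, rfl⟩⟩ := (mem_baseBlock_inner_iff hB hnk x y a).1
        ⟨hx, hy, fun h ↦ hne (by rw [h])⟩
      · exact .inl ⟨⟨a, hj⟩, ⟨rfl, rfl⟩, rfl, rfl⟩
      · exact .inr ⟨⟨a, hj⟩, ⟨rfl, rfl⟩, rfl, rfl⟩
    · rintro (⟨i, ⟨rfl, rfl⟩, rfl, rfl⟩ | ⟨i, ⟨rfl, rfl⟩, rfl, rfl⟩)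
      · obtain ⟨hx, hy, hne⟩ := (mem_baseBlock_inner_iff hB hnk 0 _ (Fin.castLE hnd i)).2
          ⟨i.2, .inl ⟨rfl, rfl⟩⟩
        exact ⟨⟨hx, hy, fun h ↦ hne (Prod.mk.inj h).1⟩, rfl⟩
      · obtain ⟨hx, hy, hne⟩ := (mem_baseBlock_inner_iff hB hnk _ 0 (Fin.castLE hnd i)).2
          ⟨i.2, .inr ⟨rfl, rfl⟩⟩
        exact ⟨⟨hx, hy, fun h ↦ hne (Prod.mk.inj h).1⟩, rfl⟩
  rw [heq, card_union_of_disjoint, card_image_of_injective, card_image_of_injective]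
  · simp only [card_univ, Fintype.card_fin]
    omega
  · intro i j h
    exact Fin.castLE_injective hnd (Prod.mk.inj (Prod.mk.inj h).1).2
  · intro i j h
    exact Fin.castLE_injective hnd (Prod.mk.inj (Prod.mk.inj h).1).2
  · rw [disjoint_left]
    rintro p hp hq
    simp only [mem_image, mem_univ, true_and] at hp hq
    obtain ⟨i, rfl⟩ := hp
    obtain ⟨j, hj⟩ := hq
    exact h0 j (Prod.mk.inj (Prod.mk.inj hj).1).1

end BaseBlock

section Orbits

variable {𝔽 : Type*} [Field 𝔽] {n d : ℕ} {ζ : 𝔽ˣ}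
  {H : Subgroup (Equiv.Perm 𝔽)} {G : Subgroup (Equiv.Perm (𝔽 × Fin d))}

theorem fiberwisePerm_affinePerm_mem
    (hH : ∀ h : Equiv.Perm 𝔽, h ∈ H ↔
      ∃ (a : 𝔽ˣ) (b : 𝔽), a ∈ Subgroup.zpowers (ζ ^ n) ∧ ∀ x : 𝔽, h x = ↑a * x + b)
    (hG : ∀ g : Equiv.Perm (𝔽 × Fin d), g ∈ G ↔
      ∃ (h : Fin d → Equiv.Perm 𝔽) (σ : Equiv.Perm (Fin d)),
        (∀ j : Fin d, h j ∈ H) ∧ ∀ p : 𝔽 × Fin d, g p = (h p.2 p.1, σ p.2))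
    {a : 𝔽ˣ} (ha : a ∈ Subgroup.zpowers (ζ ^ n)) (b : Fin d → 𝔽) (σ : Equiv.Perm (Fin d)) :
    fiberwisePerm (fun j ↦ affinePerm a (b j)) σ ∈ G :=
  (hG _).2 ⟨fun j ↦ affinePerm a (b j), σ, fun j ↦ (hH _).2 ⟨a, b j, ha, fun _ ↦ rfl⟩, fun _ ↦ rfl⟩

/-- `G` acts on points by `(x, j) ↦ (a j * x + b j, σ j)` with `a j ∈ ⟨ζⁿ⟩`. -/
theorem exists_affine_of_mem
    (hH : ∀ h : Equiv.Perm 𝔽, h ∈ H ↔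
      ∃ (a : 𝔽ˣ) (b : 𝔽), a ∈ Subgroup.zpowers (ζ ^ n) ∧ ∀ x : 𝔽, h x = ↑a * x + b)
    (hG : ∀ g : Equiv.Perm (𝔽 × Fin d), g ∈ G ↔
      ∃ (h : Fin d → Equiv.Perm 𝔽) (σ : Equiv.Perm (Fin d)),
        (∀ j : Fin d, h j ∈ H) ∧ ∀ p : 𝔽 × Fin d, g p = (h p.2 p.1, σ p.2))
    {g : Equiv.Perm (𝔽 × Fin d)} (hg : g ∈ G) :
    ∃ (a : Fin d → 𝔽ˣ) (b : Fin d → 𝔽) (σ : Equiv.Perm (Fin d)),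
      (∀ j, a j ∈ Subgroup.zpowers (ζ ^ n)) ∧ ∀ p, g p = (a p.2 * p.1 + b p.2, σ p.2) := by
  obtain ⟨h, σ, hh, hg⟩ := (hG g).1 hg
  choose a b ha hab using fun j ↦ (hH (h j)).1 (hh j)
  exact ⟨a, b, σ, ha, fun p ↦ by rw [hg, hab]⟩

variable [Fintype 𝔽] [DecidableEq 𝔽] {B : Finset (𝔽 × Fin d)}
  {ℬ : Finset (Finset (𝔽 × Fin d))}

/-- The number of blocks through two points in distinct classes. -/
theorem card_blocks_mul_of_outer
    (hH : ∀ h : Equiv.Perm 𝔽, h ∈ H ↔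
      ∃ (a : 𝔽ˣ) (b : 𝔽), a ∈ Subgroup.zpowers (ζ ^ n) ∧ ∀ x : 𝔽, h x = ↑a * x + b)
    (hG : ∀ g : Equiv.Perm (𝔽 × Fin d), g ∈ G ↔
      ∃ (h : Fin d → Equiv.Perm 𝔽) (σ : Equiv.Perm (Fin d)),
        (∀ j : Fin d, h j ∈ H) ∧ ∀ p : 𝔽 × Fin d, g p = (h p.2 p.1, σ p.2))
    (hℬ : ∀ s, s ∈ ℬ ↔ ∃ g ∈ G, B.image ⇑g = s)
    {u v : 𝔽 × Fin d} (huv : u.2 ≠ v.2) :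
    #{s ∈ ℬ | u ∈ s ∧ v ∈ s} * (Fintype.card 𝔽 * Fintype.card 𝔽 * (d * (d - 1))) =
      #ℬ * #{q ∈ B.offDiag | ¬ q.1.2 = q.2.2} := by
  set O : Finset ((𝔽 × Fin d) × 𝔽 × Fin d) := {q | q.1.2 ≠ q.2.2} with hO
  have hmem : ∀ q, q ∈ O ↔ q.1.2 ≠ q.2.2 := by simp [hO]
  have hcard : #O = Fintype.card 𝔽 * Fintype.card 𝔽 * (d * (d - 1)) := by
    have : #O = #((univ : Finset (𝔽 × 𝔽)) ×ˢ (univ : Finset (Fin d)).offDiag) := by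
      refine card_nbij' (fun q ↦ ((q.1.1, q.2.1), q.1.2, q.2.2))
        (fun q ↦ ((q.1.1, q.2.1), q.1.2, q.2.2)) ?_ ?_ ?_ ?_
      · intro q hq
        simpa using (hmem q).1 hq
      · intro q hq
        simpa [hmem] using hq
      · intro q _; rfl
      · intro q _; rfl
    rw [this, card_product, offDiag_card]
    simp [Nat.mul_sub]
  have hB : ({q ∈ O | q.1 ∈ B ∧ q.2 ∈ B} : Finset _) = {q ∈ B.offDiag | ¬ q.1.2 = q.2.2} := by
    ext q
    simp only [mem_filter, hmem, mem_offDiag]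
    constructor
    · rintro ⟨h, h1, h2⟩
      exact ⟨⟨h1, h2, fun e ↦ h (by rw [e])⟩, h⟩
    · rintro ⟨⟨h1, h2, -⟩, h⟩
      exact ⟨h, h1, h2⟩
  rw [← hcard, ← hB]
  refine card_blocks_mul_card_orbit hℬ (p := (u, v)) ?_ ?_ ((hmem _).2 huv)
  · intro g hg q hq
    obtain ⟨a, b, σ, -, hg⟩ := exists_affine_of_mem hH hG hg
    rw [hmem] at hq ⊢
    simpa [hg] using hq
  · intro q hq r hr
    rw [hmem] at hq hr
    obtain ⟨σ, h1, h2⟩ := exists_perm_apply_eq_apply_eq hq hr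
    refine ⟨_, fiberwisePerm_affinePerm_mem hH hG (one_mem _)
      (fun j ↦ if j = q.1.2 then r.1.1 - q.1.1 else r.2.1 - q.2.1) σ, ?_, ?_⟩
    · ext <;> simp [fiberwisePerm, affinePerm, h1]
    · ext <;> simp [fiberwisePerm, affinePerm, h2, hq.symm]

/-- The number of blocks through two points in a common class. -/
theorem card_blocks_mul_of_inner
    (hH : ∀ h : Equiv.Perm 𝔽, h ∈ H ↔
      ∃ (a : 𝔽ˣ) (b : 𝔽), a ∈ Subgroup.zpowers (ζ ^ n) ∧ ∀ x : 𝔽, h x = ↑a * x + b)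
    (hG : ∀ g : Equiv.Perm (𝔽 × Fin d), g ∈ G ↔
      ∃ (h : Fin d → Equiv.Perm 𝔽) (σ : Equiv.Perm (Fin d)),
        (∀ j : Fin d, h j ∈ H) ∧ ∀ p : 𝔽 × Fin d, g p = (h p.2 p.1, σ p.2))
    (hℬ : ∀ s, s ∈ ℬ ↔ ∃ g ∈ G, B.image ⇑g = s)
    {k : ℕ} (hn : 0 < n) (hnk : n ≤ k - n) (hnd : n ≤ d) (hdvd : n ∣ orderOf ζ)
    (hζ : ∀ u : 𝔽ˣ, u ∈ Subgroup.zpowers ζ) (hneg : -1 ∈ Subgroup.zpowers (ζ ^ n))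
    (hB : ∀ p : 𝔽 × Fin d, p ∈ B ↔
      ((p.1 = 0 ∧ (p.2 : ℕ) < k - n) ∨ (p.1 = (↑ζ : 𝔽) ^ (p.2 : ℕ) ∧ (p.2 : ℕ) < n)))
    {x y : 𝔽} {j : Fin d} (hxy : x ≠ y) :
    #{s ∈ ℬ | (x, j) ∈ s ∧ (y, j) ∈ s} * (Fintype.card 𝔽 * d * orderOf (ζ ^ n)) = #ℬ * 2 := by
  set w : 𝔽ˣ := Units.mk0 (y - x) (sub_ne_zero.2 hxy.symm) with hw
  set K := Subgroup.zpowers (ζ ^ n) with hK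
  classical
  set O : Finset ((𝔽 × Fin d) × 𝔽 × Fin d) :=
    {q | q.1.2 = q.2.2 ∧ ∃ a ∈ K, q.2.1 - q.1.1 = (a * w : 𝔽ˣ)} with hO
  have hmem : ∀ q, q ∈ O ↔ q.1.2 = q.2.2 ∧ ∃ a ∈ K, q.2.1 - q.1.1 = (a * w : 𝔽ˣ) := by
    simp [hO]
  have hcard : #O = Fintype.card 𝔽 * d * orderOf (ζ ^ n) := by
    have hOimg : O = (univ : Finset ((𝔽 × Fin d) × K)).image
        (fun t ↦ (t.1, (t.1.1 + ((t.2 * w : 𝔽ˣ) : 𝔽), t.1.2))) := by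
      ext ⟨⟨x, i⟩, y, j⟩
      simp only [hmem, mem_image, mem_univ, true_and]
      constructor
      · rintro ⟨rfl, a, ha, h⟩
        exact ⟨((x, i), ⟨a, ha⟩), by simp [← h]⟩
      · rintro ⟨⟨⟨x', i'⟩, a⟩, h⟩
        simp only [Prod.mk.injEq] at h
        obtain ⟨⟨rfl, rfl⟩, rfl, rfl⟩ := h
        exact ⟨rfl, a, a.2, by simp⟩
    rw [hOimg, card_image_of_injective]
    · rw [card_univ, Fintype.card_prod, Fintype.card_prod, Fintype.card_fin,
        ← Nat.card_eq_fintype_card (α := K), hK, Nat.card_zpowers]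
    · rintro ⟨⟨x, i⟩, a⟩ ⟨⟨y, j⟩, b⟩ h
      simp only [Prod.mk.injEq] at h
      obtain ⟨⟨rfl, rfl⟩, h, -⟩ := h
      have h' := mul_right_cancel (Units.ext (add_left_cancel h))
      rw [Subtype.ext h']
  obtain ⟨i, hi, a, ha, hia⟩ := exists_pow_lt_eq_mul hζ hn w
  have huniq : ∀ m < n, ∀ b ∈ K, ζ ^ m = b * w → m = i := by
    intro m hm b hb h
    refine eq_of_pow_eq_mul_pow hdvd hm hi (K.mul_mem hb (K.inv_mem ha)) ?_
    rw [hia, h]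
    group
  have hfilter : ({q ∈ O | q.1 ∈ B ∧ q.2 ∈ B} : Finset _) =
      {((0, Fin.castLE hnd ⟨i, hi⟩), ((ζ : 𝔽) ^ i, Fin.castLE hnd ⟨i, hi⟩)),
        (((ζ : 𝔽) ^ i, Fin.castLE hnd ⟨i, hi⟩), (0, Fin.castLE hnd ⟨i, hi⟩))} := by
    ext ⟨⟨x, l⟩, y, m⟩
    simp only [mem_filter, hmem, mem_insert, mem_singleton, Prod.mk.injEq]
    constructor
    · rintro ⟨⟨rfl, b, hb, hd⟩, hx, hy⟩
      obtain ⟨hl, h⟩ := (mem_baseBlock_inner_iff hB hnk x y l).1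
        ⟨hx, hy, fun h ↦ (b * w).ne_zero (by rw [← hd, h, sub_self])⟩
      have hli : (l : ℕ) = i := by
        rcases h with ⟨rfl, rfl⟩ | ⟨rfl, rfl⟩
        · exact huniq l hl b hb (Units.ext (by rw [← hd]; simp))
        · refine huniq l hl (-1 * b) (K.mul_mem hneg hb) (Units.ext ?_)
          rw [mul_assoc, Units.val_mul, ← hd]
          simp
      have hli' : l = Fin.castLE hnd ⟨i, hi⟩ := Fin.ext hli
      rw [hli] at h
      rcases h with ⟨rfl, rfl⟩ | ⟨rfl, rfl⟩
      · exact .inl ⟨⟨rfl, hli'⟩, rfl, hli'⟩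
      · exact .inr ⟨⟨rfl, hli'⟩, rfl, hli'⟩
    · rintro (⟨⟨rfl, rfl⟩, rfl, rfl⟩ | ⟨⟨rfl, rfl⟩, rfl, rfl⟩)
      · obtain ⟨h1, h2, -⟩ := (mem_baseBlock_inner_iff hB hnk 0 _ (Fin.castLE hnd ⟨i, hi⟩)).2
          ⟨hi, .inl ⟨rfl, rfl⟩⟩
        exact ⟨⟨rfl, a, ha, by simp [← hia]⟩, h1, h2⟩
      · obtain ⟨h1, h2, -⟩ := (mem_baseBlock_inner_iff hB hnk _ 0 (Fin.castLE hnd ⟨i, hi⟩)).2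
          ⟨hi, .inr ⟨rfl, rfl⟩⟩
        exact ⟨⟨rfl, -1 * a, K.mul_mem hneg ha, by rw [mul_assoc, ← hia]; simp⟩, h1, h2⟩
  have htwo : #{q ∈ O | q.1 ∈ B ∧ q.2 ∈ B} = 2 := by
    rw [hfilter]
    exact card_pair fun h ↦ pow_ne_zero i ζ.ne_zero (Prod.mk.inj (Prod.mk.inj h).1).1.symm
  rw [← hcard, ← htwo]
  refine card_blocks_mul_card_orbit hℬ (p := ((x, j), (y, j))) ?_ ?_
    ((hmem _).2 ⟨rfl, 1, K.one_mem, by simp [hw]⟩)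
  · intro g hg q hq
    obtain ⟨a, b, σ, ha, hg⟩ := exists_affine_of_mem hH hG hg
    rw [hmem] at hq ⊢
    obtain ⟨h, e, he, hd⟩ := hq
    refine ⟨by simp [hg, h], a q.1.2 * e, K.mul_mem (ha _) he, ?_⟩
    rw [mul_assoc, Units.val_mul, ← hd, hg, hg, h]
    ring
  · intro q hq r hr
    rw [hmem] at hq hr
    obtain ⟨hq, a, ha, hqa⟩ := hq
    obtain ⟨hr, b, hb, hrb⟩ := hr
    refine ⟨_, fiberwisePerm_affinePerm_mem hH hG (K.mul_mem hb (K.inv_mem ha))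
      (fun _ ↦ r.1.1 - (b * a⁻¹ : 𝔽ˣ) * q.1.1) (Equiv.swap q.1.2 r.1.2), ?_, ?_⟩
    · ext <;> simp [fiberwisePerm, affinePerm]
    · ext
      · have h1 : q.2.1 = q.1.1 + (a * w : 𝔽ˣ) := by rw [← hqa]; ring
        have h2 : r.2.1 = r.1.1 + (b * w : 𝔽ˣ) := by rw [← hrb]; ring
        have h3 : (a : 𝔽) ≠ 0 := a.ne_zero
        simp only [fiberwisePerm, affinePerm, Equiv.coe_fn_mk, h1, h2]
        push_cast
        field_simp
        ring
      · simp [fiberwisePerm, ← hq, ← hr]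

end Orbits

/-- **Construction 5.5 / Theorem 5.6.** For a useful pair `[n, c]` with
`c + n = C(k,2)`, `k ≥ 2n`, `d = 1 + (c−1)/n`, the `G`-orbit of the base block `B`
is the block set of a block-transitive, point-imprimitive `2`-(cd, k, λ) design with
Delandtsheer–Doyen parameters `(m, n) = (1, n)`. -/
theorem new_design_construction
    (n c k d : ℕ) (hn : 2 ≤ n) (hc : IsPrimePow c) (hmod : c % (2 * n) = 1)
    (hck : c + n = Nat.choose k 2) (hk : 2 * n ≤ k) (hd : d = 1 + (c - 1) / n)
    (𝔽 : Type*) [Field 𝔽] [Fintype 𝔽] [DecidableEq 𝔽]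
    (hcard : Fintype.card 𝔽 = c)
    (ζ : 𝔽ˣ) (hζ : ∀ u : 𝔽ˣ, u ∈ Subgroup.zpowers ζ)
    (H : Subgroup (Equiv.Perm 𝔽))
    (hH : ∀ h : Equiv.Perm 𝔽, h ∈ H ↔
      ∃ (a : 𝔽ˣ) (b : 𝔽), a ∈ Subgroup.zpowers (ζ ^ n) ∧ ∀ x : 𝔽, h x = ↑a * x + b)
    (G : Subgroup (Equiv.Perm (𝔽 × Fin d)))
    (hG : ∀ g : Equiv.Perm (𝔽 × Fin d), g ∈ G ↔
      ∃ (h : Fin d → Equiv.Perm 𝔽) (σ : Equiv.Perm (Fin d)),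
        (∀ j : Fin d, h j ∈ H) ∧ ∀ p : 𝔽 × Fin d, g p = (h p.2 p.1, σ p.2))
    -- the base block `B = {(0,i), (ζⁱ,i) : 0 ≤ i ≤ n−1} ∪ {(0,i) : n ≤ i ≤ k−n−1}`
    (B : Finset (𝔽 × Fin d))
    (hB : ∀ p : 𝔽 × Fin d, p ∈ B ↔
      ((p.1 = 0 ∧ (p.2 : ℕ) < k - n) ∨ (p.1 = (↑ζ : 𝔽) ^ (p.2 : ℕ) ∧ (p.2 : ℕ) < n)))
    -- the partition `𝒞` into the classes `C_j = 𝔽 × {j}`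
    (𝒞 : Finset (Finset (𝔽 × Fin d)))
    (h𝒞 : ∀ s : Finset (𝔽 × Fin d),
      s ∈ 𝒞 ↔ ∃ j : Fin d, s = Finset.univ.filter fun p : 𝔽 × Fin d => p.2 = j) :
    B.card = k ∧
    ∃ (lam : ℕ) (ℬ : Finset (Finset (𝔽 × Fin d))),
      0 < lam ∧ B ∈ ℬ ∧
      (∀ s : Finset (𝔽 × Fin d), s ∈ ℬ ↔ ∃ g ∈ G, B.image ⇑g = s) ∧
      (∀ B' ∈ ℬ, B'.card = k) ∧
      (∀ p : Finset (𝔽 × Fin d), p.card = 2 → (ℬ.filter fun B' => p ⊆ B').card = lam) ∧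
      (∀ g ∈ G, ∀ B' ∈ ℬ, B'.image ⇑g ∈ ℬ) ∧
      (∀ B₁ ∈ ℬ, ∀ B₂ ∈ ℬ, ∃ g ∈ G, B₁.image ⇑g = B₂) ∧
      𝒞.card = d ∧ (∀ C ∈ 𝒞, C.card = c) ∧
      (∀ x : 𝔽 × Fin d, ∃! C, C ∈ 𝒞 ∧ x ∈ C) ∧
      (∀ g ∈ G, ∀ C ∈ 𝒞, C.image ⇑g ∈ 𝒞) ∧
      innerPairs 𝒞 B = n ∧ outerPairs 𝒞 B = 1 * c := by
  have hc1 : 1 < c := hc.one_lt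
  obtain ⟨m, hm⟩ : ∃ m, c = 2 * n * m + 1 := ⟨c / (2 * n), by
    have := Nat.div_add_mod c (2 * n)
    omega⟩
  have hm0 : 0 < m := by
    rcases Nat.eq_zero_or_pos m with rfl | h
    · omega
    · exact h
  have hdm : (c - 1) / n = 2 * m := by
    rw [hm, Nat.add_sub_cancel, mul_comm 2 n, mul_assoc, Nat.mul_div_cancel_left _ (by omega)]
  have hkk : k * (k - 1) = 2 * (c + n) := by
    rw [hck, Nat.choose_two_right, Nat.mul_div_cancel' (Nat.even_mul_pred_self k).two_dvd]
  have hnk : n ≤ k - n := by omega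
  have hkd : k - n ≤ d := by
    obtain ⟨t, rfl⟩ := Nat.exists_eq_add_of_le hk
    have h1 : 2 * n + t - 1 = 2 * (n - 1) + 1 + t := by omega
    obtain ⟨l, rfl⟩ := Nat.exists_eq_add_of_le hn
    rw [hd, hdm]
    by_contra! hlt
    have h2 : 2 * m ≤ l + t := by omega
    have h3 : (2 + l) * (2 * m) ≤ (2 + l) * (l + t) := Nat.mul_le_mul_left _ h2
    rw [show 2 + l - 1 = l + 1 by omega] at h1
    rw [h1, hm] at hkk
    nlinarith
  have hnd : n ≤ d := hnk.trans hkd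
  have hd1 : d - 1 = 2 * m := by omega
  have hord : orderOf ζ = 2 * n * m := by
    rw [orderOf_eq_card_of_forall_mem_zpowers hζ, Nat.card_eq_fintype_card, Fintype.card_units,
      hcard, hm, Nat.add_sub_cancel]
  have hdvd : n ∣ orderOf ζ := hord ▸ ⟨2 * m, by ring⟩
  have hordn : orderOf (ζ ^ n) = d - 1 := by
    rw [orderOf_pow_of_dvd (by omega) hdvd, hord, hd1, mul_comm 2 n, mul_assoc,
      Nat.mul_div_cancel_left _ (by omega)]
  have hneg : -1 ∈ Subgroup.zpowers (ζ ^ n) := by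
    obtain ⟨e, he⟩ := Subgroup.mem_zpowers_iff.1 (hζ (-1))
    have h1 : ζ ^ (2 * e) = 1 := by
      rw [mul_comm, zpow_mul, he]
      simp
    have h2 := orderOf_dvd_iff_zpow_eq_one.2 h1
    rw [hord] at h2
    obtain ⟨f, hf⟩ := h2
    refine Subgroup.mem_zpowers_iff.2 ⟨m * f, ?_⟩
    rw [← he, ← zpow_natCast, ← zpow_mul]
    congr 1
    push_cast at hf
    linarith
  have hBk : #B = k := card_baseBlock hB hnk hkd
  have hinner : innerPairs 𝒞 B = n := card_baseBlock_innerPairs hB hnk hnd 𝒞 h𝒞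
  have hsplit : innerPairs 𝒞 B + outerPairs 𝒞 B = k.choose 2 := by
    rw [innerPairs, outerPairs, card_filter_add_card_filter_not, card_powersetCard, hBk]
  have houter : #{q ∈ B.offDiag | ¬ q.1.2 = q.2.2} = 2 * c := by
    have h1 := card_filter_add_card_filter_not (s := B.offDiag) (fun q ↦ q.1.2 = q.2.2)
    rw [card_baseBlock_offDiag_inner hB hnk hnd, offDiag_card, hBk, ← Nat.mul_sub_one, hkk] at h1
    omega
  classical
  set ℬ : Finset (Finset (𝔽 × Fin d)) := univ.filter fun s ↦ ∃ g ∈ G, B.image ⇑g = s with hℬdef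
  have hℬ : ∀ s, s ∈ ℬ ↔ ∃ g ∈ G, B.image ⇑g = s := by simp [hℬdef]
  have hBmem : B ∈ ℬ := (hℬ B).2 ⟨1, G.one_mem, by simp⟩
  have hv : 0 < c * d * (d - 1) := Nat.mul_pos (Nat.mul_pos (by omega) (by omega)) (by omega)
  have hcount : ∀ u v : 𝔽 × Fin d, u ≠ v →
      #{s ∈ ℬ | u ∈ s ∧ v ∈ s} * (c * d * (d - 1)) = #ℬ * 2 := by
    rintro ⟨x, i⟩ ⟨y, j⟩ hne
    by_cases hij : i = j
    · subst hij
      have := card_blocks_mul_of_inner hH hG hℬ (by omega) hnk hnd hdvd hζ hneg hB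
        (x := x) (y := y) (j := i) (fun h ↦ hne (by rw [h]))
      rwa [hcard, hordn] at this
    · have := card_blocks_mul_of_outer hH hG hℬ (u := (x, i)) (v := (y, j)) hij
      rw [hcard, houter] at this
      refine Nat.eq_of_mul_eq_mul_right (show 0 < c by omega) ?_
      linarith
  have hpair : ∀ p : Finset (𝔽 × Fin d), #p = 2 →
      #{s ∈ ℬ | p ⊆ s} * (c * d * (d - 1)) = #ℬ * 2 := by
    intro p hp
    obtain ⟨u, v, huv, rfl⟩ := card_eq_two.1 hp
    simpa [insert_subset_iff] using hcount u v huv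
  have hclass : ∀ j : Fin d, #{p : 𝔽 × Fin d | p.2 = j} = c := by
    intro j
    rw [show ({p : 𝔽 × Fin d | p.2 = j} : Finset _) = univ ×ˢ {j} by ext p; simp [mem_product, - product_singleton]]
    simp [hcard]
  refine ⟨hBk, #ℬ * 2 / (c * d * (d - 1)), ℬ, ?_, hBmem, hℬ, ?_, ?_, ?_, ?_, ?_, ?_, ?_, ?_,
    hinner, by omega⟩
  · have h2 : 1 < #B := by omega
    obtain ⟨u, -, v, -, huv⟩ := one_lt_card.1 h2
    rw [← hcount u v huv, Nat.mul_div_cancel _ hv]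
    refine Nat.pos_of_ne_zero fun h0 ↦ ?_
    have := hcount u v huv
    rw [h0, zero_mul] at this
    have := card_pos.2 ⟨B, hBmem⟩
    omega
  · intro s hs
    obtain ⟨g, -, rfl⟩ := (hℬ s).1 hs
    rw [card_image_of_injective _ g.injective, hBk]
  · intro p hp
    rw [← hpair p hp, Nat.mul_div_cancel _ hv]
  · intro g hg s hs
    obtain ⟨g', hg', rfl⟩ := (hℬ s).1 hs
    exact (hℬ _).2 ⟨g * g', G.mul_mem hg hg', by simp [image_image]⟩
  · intro s hs t ht
    obtain ⟨g, hg, rfl⟩ := (hℬ s).1 hs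
    obtain ⟨g', hg', rfl⟩ := (hℬ t).1 ht
    refine ⟨g' * g⁻¹, G.mul_mem hg' (G.inv_mem hg), ?_⟩
    rw [image_image]
    congr 1
    ext p <;> simp
  · have h1 : 𝒞 = univ.image fun j : Fin d ↦ ({p : 𝔽 × Fin d | p.2 = j} : Finset _) := by
      ext s
      simp [h𝒞, eq_comm]
    rw [h1, card_image_of_injective, card_univ, Fintype.card_fin]
    intro i j hij
    have : ((0 : 𝔽), i) ∈ ({p : 𝔽 × Fin d | p.2 = j} : Finset _) := by
      beta_reduce at hij
      rw [← hij]
      simp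
    simpa using this
  · intro C hC
    obtain ⟨j, rfl⟩ := (h𝒞 C).1 hC
    exact hclass j
  · intro x
    refine ⟨_, ⟨(h𝒞 _).2 ⟨x.2, rfl⟩, by simp⟩, ?_⟩
    rintro C ⟨hC, hx⟩
    obtain ⟨j, rfl⟩ := (h𝒞 C).1 hC
    rw [(by simpa using hx : x.2 = j)]
  · intro g hg C hC
    obtain ⟨j, rfl⟩ := (h𝒞 C).1 hC
    obtain ⟨a, b, σ, -, hg⟩ := exists_affine_of_mem hH hG hg
    refine (h𝒞 _).2 ⟨σ j, eq_of_subset_of_card_le ?_ ?_⟩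
    · intro q hq
      simp only [mem_image, mem_filter, mem_univ, true_and] at hq ⊢
      obtain ⟨p, rfl, rfl⟩ := hq
      rw [hg]
    · rw [card_image_of_injective _ g.injective, hclass, hclass]
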